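/- arXiv:1802.01965 — 2 statements merged into one kernel-verified Lean document; each statement's English description precedes it below -/
import Mathlib

section
/- The Gibbs function G is four times differentiable with G'''(τ) = ∫_ℝ (r − G'(τ))³ dλ_τ(r) and G''''(τ) = ∫_ℝ (r − G'(τ))⁴ dλ_τ(r) − 3 G''(τ)², and both G''' and G'''' are bounded functions on ℝ. -/
open MeasureTheory Real

/-- The Gibbs function `G(τ) = log ∫ exp(τ r - V(r)) dr`. -/
noncomputable def gibbsG (V : ℝ → ℝ) (τ : ℝ) : ℝ :=
  Real.log (∫ r : ℝ, Real.exp (τ * r - V r))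

/-- The Gibbs probability measure `λ_τ` with density `exp(τ r - V(r) - G(τ))`
with respect to Lebesgue measure. -/
noncomputable def gibbsMeasure (V : ℝ → ℝ) (τ : ℝ) : Measure ℝ :=
  (volume : Measure ℝ).withDensity
    (fun r => ENNReal.ofReal (Real.exp (τ * r - V r - gibbsG V τ)))

section ConvexPotential

/-- A twice differentiable function with `f'' ≥ c` lies above its tangent parabolas of
curvature `c`. -/
lemma tangent_parabola_le {f : ℝ → ℝ} {c : ℝ} (hf : ContDiff ℝ 2 f)
    (hc : ∀ x, c ≤ deriv (deriv f) x) (a x : ℝ) :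
    f a + deriv f a * (x - a) + c / 2 * (x - a) ^ 2 ≤ f x := by
  have hf1 : Differentiable ℝ f := hf.differentiable (by norm_num)
  have hf2 : Differentiable ℝ (deriv f) :=
    (hf.iterate_deriv' 1 1).differentiable (by norm_num)
  set g : ℝ → ℝ := fun y => f y - c / 2 * (y - a) ^ 2 with hg
  have hg1 : ∀ y, HasDerivAt g (deriv f y - c * (y - a)) y := fun y => by
    refine ((hf1 y).hasDerivAt.sub
      ((((hasDerivAt_id y).sub_const a).pow 2).const_mul (c / 2))).congr_deriv ?_
    simp only [id]
    push_cast
    ring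
  have hg1' : deriv g = fun y => deriv f y - c * (y - a) := funext fun y => (hg1 y).deriv
  have hg2 : ∀ y, HasDerivAt (deriv g) (deriv (deriv f) y - c) y := fun y => by
    rw [hg1']
    refine ((hf2 y).hasDerivAt.sub
      (((hasDerivAt_id y).sub_const a).const_mul c)).congr_deriv ?_
    ring
  have hconv : ConvexOn ℝ Set.univ g := by
    refine convexOn_univ_of_deriv2_nonneg (fun y => (hg1 y).differentiableAt)
      (fun y => (hg2 y).differentiableAt) fun y => ?_
    simp only [Function.iterate_succ, Function.iterate_zero, Function.comp_apply, id]
    rw [(hg2 y).deriv]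
    linarith [hc y]
  have hga : HasDerivAt g (deriv f a) a := by simpa using hg1 a
  have key : g a + deriv f a * (x - a) ≤ g x := by
    rcases lt_trichotomy a x with h | h | h
    · have := hconv.le_slope_of_hasDerivAt (Set.mem_univ _) (Set.mem_univ _) h hga
      rw [slope_def_field, le_div_iff₀ (by linarith)] at this
      linarith
    · simp [h]
    · have := hconv.slope_le_of_hasDerivAt (Set.mem_univ _) (Set.mem_univ _) h hga
      rw [slope_def_field, div_le_iff₀ (by linarith)] at this
      linarith
  simp only [hg] at key
  nlinarith

/-- The derivative of a function with `f'' ≥ c > 0` is surjective. -/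
lemma exists_deriv_eq_of_pos_le_deriv2 {f : ℝ → ℝ} {c : ℝ} (hc₀ : 0 < c) (hf : ContDiff ℝ 2 f)
    (hc : ∀ x, c ≤ deriv (deriv f) x) (τ : ℝ) : ∃ a, deriv f a = τ := by
  have hf2 : Differentiable ℝ (deriv f) :=
    (hf.iterate_deriv' 1 1).differentiable (by norm_num)
  have hslope : ∀ x y, x ≤ y → c * (y - x) ≤ deriv f y - deriv f x := fun x y hxy =>
    mul_sub_le_image_sub_of_le_deriv hf2 hc hxy
  set R : ℝ := |τ - deriv f 0| / c
  have hR : 0 ≤ R := by positivity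
  have hcR : c * R = |τ - deriv f 0| := by simp only [R]; field_simp
  have h1 := hslope 0 R hR
  have h2 := hslope (-R) 0 (by linarith)
  have h3 := abs_le.1 (le_refl |τ - deriv f 0|)
  obtain ⟨a, -, ha⟩ := intermediate_value_Icc (show -R ≤ R by linarith)
    hf2.continuous.continuousOn (show τ ∈ Set.Icc (deriv f (-R)) (deriv f R) from
      ⟨by nlinarith, by nlinarith⟩)
  exact ⟨a, ha⟩

variable {V : ℝ → ℝ} {c₁ c₂ : ℝ}

lemma integrable_exp_linear_sub_potential (hc₁ : 0 < c₁) (hV : ContDiff ℝ 2 V)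
    (hlow : ∀ r, c₁ ≤ deriv (deriv V) r) (τ : ℝ) :
    Integrable fun r => exp (τ * r - V r) := by
  obtain ⟨a, rfl⟩ := exists_deriv_eq_of_pos_le_deriv2 hc₁ hV hlow τ
  have hgauss := ((integrable_exp_neg_mul_sq (half_pos hc₁)).comp_sub_right a).const_mul
    (exp (deriv V a * a - V a))
  have hcont := hV.continuous
  refine hgauss.mono' (by fun_prop) (.of_forall fun r => ?_)
  rw [norm_of_nonneg (exp_pos _).le, ← exp_add]
  exact exp_le_exp.2 (by linarith [tangent_parabola_le hV hlow a r])

lemma exists_integral_sub_pow_four_mul_exp_le (hc₁ : 0 < c₁) (hV : ContDiff ℝ 2 V)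
    (hlow : ∀ r, c₁ ≤ deriv (deriv V) r) (hhigh : ∀ r, deriv (deriv V) r ≤ c₂) :
    ∃ K, 0 ≤ K ∧ ∀ τ, ∃ a,
      ∫ r, (r - a) ^ 4 * exp (τ * r - V r) ≤ K * ∫ r, exp (τ * r - V r) := by
  have hc₂ : 0 < c₂ := hc₁.trans_le ((hlow 0).trans (hhigh 0))
  have hI₁ : Integrable fun s : ℝ => s ^ 4 * exp (-(c₁ / 2) * s ^ 2) := by
    simpa using integrable_rpow_mul_exp_neg_mul_sq (half_pos hc₁) (s := (4 : ℕ)) (by norm_num)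
  have hI₂ := integrable_exp_neg_mul_sq (half_pos hc₂)
  set A := ∫ s : ℝ, s ^ 4 * exp (-(c₁ / 2) * s ^ 2)
  set B := ∫ s : ℝ, exp (-(c₂ / 2) * s ^ 2)
  have hA : 0 ≤ A := integral_nonneg fun s => by positivity
  have hB : 0 < B := integral_exp_pos hI₂
  refine ⟨A / B, by positivity, fun τ => ?_⟩
  obtain ⟨a, rfl⟩ := exists_deriv_eq_of_pos_le_deriv2 hc₁ hV hlow τ
  set E := exp (deriv V a * a - V a)
  have hupper : ∫ r, (r - a) ^ 4 * exp (deriv V a * r - V r) ≤ E * A := by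
    simp only [A]
    rw [← integral_sub_right_eq_self (fun s : ℝ => s ^ 4 * exp (-(c₁ / 2) * s ^ 2)) a,
      ← integral_const_mul]
    refine integral_mono_of_nonneg (.of_forall fun r => by positivity)
      ((hI₁.comp_sub_right a).const_mul E) (.of_forall fun r => ?_)
    have : exp (deriv V a * r - V r) ≤ E * exp (-(c₁ / 2) * (r - a) ^ 2) := by
      rw [← exp_add]
      exact exp_le_exp.2 (by linarith [tangent_parabola_le hV hlow a r])
    calc (r - a) ^ 4 * exp (deriv V a * r - V r)
        ≤ (r - a) ^ 4 * (E * exp (-(c₁ / 2) * (r - a) ^ 2)) := by gcongr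
      _ = _ := by ring
  have hlower : E * B ≤ ∫ r, exp (deriv V a * r - V r) := by
    simp only [B]
    rw [← integral_sub_right_eq_self (fun s : ℝ => exp (-(c₂ / 2) * s ^ 2)) a,
      ← integral_const_mul]
    refine integral_mono ((hI₂.comp_sub_right a).const_mul E)
      (integrable_exp_linear_sub_potential hc₁ hV hlow _) fun r => ?_
    have hneg := tangent_parabola_le (f := fun x => -V x) (c := -c₂) hV.neg
      (by simpa [deriv.fun_neg'] using hhigh) a r
    simp only [deriv.fun_neg'] at hneg
    simp only [E, ← exp_add]
    exact exp_le_exp.2 (by linarith)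
  refine ⟨a, hupper.trans ?_⟩
  calc E * A = A / B * (E * B) := by field_simp
    _ ≤ _ := by gcongr

end ConvexPotential

section CentralMoments

variable {ν : Measure ℝ}

lemma integrable_sub_pow_of_integrable_pow (hν : ∀ n : ℕ, Integrable (fun r => r ^ n) ν)
    (a : ℝ) (n : ℕ) : Integrable (fun r => (r - a) ^ n) ν := by
  simp only [sub_eq_add_neg, add_pow]
  exact integrable_finsetSum _ fun k _ => ((hν k).mul_const _).mul_const _

variable [IsProbabilityMeasure ν]

lemma integral_sub_pow_two (hν : ∀ n : ℕ, Integrable (fun r => r ^ n) ν) (a : ℝ) :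
    ∫ r, (r - a) ^ 2 ∂ν = ∫ r, r ^ 2 ∂ν - 2 * a * ∫ r, r ^ 1 ∂ν + a ^ 2 := by
  have h : ∀ r : ℝ, (r - a) ^ 2 = r ^ 2 + -(2 * a) * r ^ 1 + a ^ 2 := fun r => by ring
  have i1 := (hν 1).const_mul (-(2 * a))
  simp only [h]
  rw [integral_add ((hν 2).fun_add i1) (integrable_const _), integral_add (hν 2) i1,
    integral_const_mul, integral_const, probReal_univ, one_smul]
  ring

lemma integral_sub_pow_three (hν : ∀ n : ℕ, Integrable (fun r => r ^ n) ν) (a : ℝ) :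
    ∫ r, (r - a) ^ 3 ∂ν
      = ∫ r, r ^ 3 ∂ν - 3 * a * ∫ r, r ^ 2 ∂ν + 3 * a ^ 2 * ∫ r, r ^ 1 ∂ν - a ^ 3 := by
  have h : ∀ r : ℝ, (r - a) ^ 3 = r ^ 3 + -(3 * a) * r ^ 2 + 3 * a ^ 2 * r ^ 1 + -a ^ 3 :=
    fun r => by ring
  have i1 := (hν 1).const_mul (3 * a ^ 2)
  have i2 := (hν 2).const_mul (-(3 * a))
  simp only [h]
  rw [integral_add (((hν 3).fun_add i2).fun_add i1) (integrable_const _),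
    integral_add ((hν 3).fun_add i2) i1, integral_add (hν 3) i2,
    integral_const_mul, integral_const_mul, integral_const, probReal_univ, one_smul]
  ring

lemma integral_sub_pow_four (hν : ∀ n : ℕ, Integrable (fun r => r ^ n) ν) (a : ℝ) :
    ∫ r, (r - a) ^ 4 ∂ν
      = ∫ r, r ^ 4 ∂ν - 4 * a * ∫ r, r ^ 3 ∂ν + 6 * a ^ 2 * ∫ r, r ^ 2 ∂ν
        - 4 * a ^ 3 * ∫ r, r ^ 1 ∂ν + a ^ 4 := by
  have h : ∀ r : ℝ, (r - a) ^ 4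
      = r ^ 4 + -(4 * a) * r ^ 3 + 6 * a ^ 2 * r ^ 2 + -(4 * a ^ 3) * r ^ 1 + a ^ 4 :=
    fun r => by ring
  have i1 := (hν 1).const_mul (-(4 * a ^ 3))
  have i2 := (hν 2).const_mul (6 * a ^ 2)
  have i3 := (hν 3).const_mul (-(4 * a))
  simp only [h]
  rw [integral_add ((((hν 4).fun_add i3).fun_add i2).fun_add i1) (integrable_const _),
    integral_add (((hν 4).fun_add i3).fun_add i2) i1, integral_add ((hν 4).fun_add i3) i2,
    integral_add (hν 4) i3, integral_const_mul, integral_const_mul, integral_const_mul,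
    integral_const, probReal_univ, one_smul]
  ring

lemma abs_integral_sub_pow_le_one_add (hν : ∀ n : ℕ, Integrable (fun r => r ^ n) ν) (a : ℝ)
    {k : ℕ} (hk : k ≤ 4) :
    |∫ r, (r - a) ^ k ∂ν| ≤ 1 + ∫ r, (r - a) ^ 4 ∂ν := by
  have i4 := integrable_sub_pow_of_integrable_pow hν a 4
  calc |∫ r, (r - a) ^ k ∂ν| ≤ ∫ r, |(r - a) ^ k| ∂ν := abs_integral_le_integral_abs
    _ ≤ ∫ r, (1 + (r - a) ^ 4) ∂ν := by
      refine integral_mono (integrable_sub_pow_of_integrable_pow hν a k).abs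
        ((integrable_const _).fun_add i4) fun r => ?_
      have h4 : (r - a) ^ 4 = |r - a| ^ 4 := by rw [Even.pow_abs (by decide)]
      simp only [abs_pow, h4]
      rcases le_total |r - a| 1 with h | h
      · linarith [pow_le_one₀ (n := k) (abs_nonneg (r - a)) h,
          pow_nonneg (abs_nonneg (r - a)) 4]
      · linarith [pow_le_pow_right₀ h hk]
    _ = 1 + ∫ r, (r - a) ^ 4 ∂ν := by
      rw [integral_add (integrable_const _) i4]
      simp

/-- The fourth central moment is controlled by the fourth moment about any point. -/
lemma integral_sub_mean_pow_four_le (hν : ∀ n : ℕ, Integrable (fun r => r ^ n) ν) {a K : ℝ}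
    (hK : ∫ r, (r - a) ^ 4 ∂ν ≤ K) :
    ∫ r, (r - ∫ s, s ^ 1 ∂ν) ^ 4 ∂ν ≤ 8 * (K + (1 + K) ^ 4) := by
  set m := ∫ s, s ^ 1 ∂ν
  have hm : |m - a| ≤ 1 + K := by
    have h := abs_integral_sub_pow_le_one_add hν a (k := 1) (by norm_num)
    have h1 : ∫ r, (r - a) ^ 1 ∂ν = m - a := by
      have := integral_sub (hν 1) (integrable_const a)
      simpa [m] using this
    rw [h1] at h
    linarith
  have hm4 : (m - a) ^ 4 ≤ (1 + K) ^ 4 := by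
    rw [← Even.pow_abs (by decide : Even 4)]
    gcongr
  have i4 := integrable_sub_pow_of_integrable_pow hν a 4
  calc ∫ r, (r - m) ^ 4 ∂ν ≤ ∫ r, (8 * (r - a) ^ 4 + 8 * (m - a) ^ 4) ∂ν := by
        refine integral_mono (integrable_sub_pow_of_integrable_pow hν m 4)
          ((i4.const_mul 8).add (integrable_const _)) fun r => ?_
        have h := (by decide : Even 4).add_pow_le (a := r - a) (b := a - m)
        have h' : (m - a) ^ 4 = (a - m) ^ 4 := by ring
        simp only [sub_add_sub_cancel] at h
        norm_num at h
        linarith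
    _ = 8 * ∫ r, (r - a) ^ 4 ∂ν + 8 * (m - a) ^ 4 := by
        rw [integral_add (i4.const_mul 8) (integrable_const _), integral_const_mul]
        simp
    _ ≤ _ := by linarith

end CentralMoments

section GibbsMoments

open ProbabilityTheory

/-- The moments of the unnormalized Gibbs density. -/
noncomputable def gibbsMoment (V : ℝ → ℝ) (n : ℕ) (τ : ℝ) : ℝ :=
  ∫ r : ℝ, r ^ n * exp (τ * r - V r)

/-- The measure with density `exp (-V)`. -/
noncomputable def gibbsBase (V : ℝ → ℝ) : Measure ℝ :=
  (volume : Measure ℝ).withDensity fun r => ENNReal.ofReal (exp (-V r))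

variable {V : ℝ → ℝ}

lemma integral_gibbsBase (hV : Continuous V) (g : ℝ → ℝ) (τ : ℝ) :
    ∫ r, g r * exp (τ * r) ∂(gibbsBase V) = ∫ r, g r * exp (τ * r - V r) := by
  rw [gibbsBase, integral_withDensity_eq_integral_toReal_smul (by fun_prop) (by simp)]
  refine integral_congr_ae (.of_forall fun r => ?_)
  simp only [ENNReal.toReal_ofReal (exp_pos _).le, smul_eq_mul, sub_eq_add_neg, exp_add]
  ring

lemma integrable_gibbsBase_iff (hV : Continuous V) (g : ℝ → ℝ) (τ : ℝ) :
    Integrable (fun r => g r * exp (τ * r)) (gibbsBase V)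
      ↔ Integrable fun r => g r * exp (τ * r - V r) := by
  rw [gibbsBase, integrable_withDensity_iff (by fun_prop) (by simp)]
  refine integrable_congr (.of_forall fun r => ?_)
  simp only [ENNReal.toReal_ofReal (exp_pos _).le, sub_eq_add_neg, exp_add]
  ring

lemma gibbsG_eq_cgf (hV : Continuous V) : gibbsG V = cgf id (gibbsBase V) := by
  ext τ
  have := integral_gibbsBase hV (fun _ => 1) τ
  simp only [one_mul] at this
  simp [gibbsG, cgf, mgf, this]

lemma mem_interior_integrableExpSet_gibbsBase (hV : Continuous V)
    (hexp : ∀ τ, Integrable fun r => exp (τ * r - V r)) (τ : ℝ) :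
    τ ∈ interior (integrableExpSet id (gibbsBase V)) := by
  have : integrableExpSet id (gibbsBase V) = Set.univ := Set.eq_univ_of_forall fun t => by
    have := (integrable_gibbsBase_iff hV (fun _ => 1) t).2 (by simpa using hexp t)
    simpa [integrableExpSet] using this
  simp [this]

lemma contDiff_gibbsG (hV : Continuous V)
    (hexp : ∀ τ, Integrable fun r => exp (τ * r - V r)) : ContDiff ℝ 4 (gibbsG V) := by
  rw [gibbsG_eq_cgf hV, contDiff_iff_contDiffAt]
  exact fun τ => (analyticAt_cgf (mem_interior_integrableExpSet_gibbsBase hV hexp τ)).contDiffAt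

lemma integrable_pow_mul_exp_linear_sub_potential (hV : Continuous V)
    (hexp : ∀ τ, Integrable fun r => exp (τ * r - V r)) (n : ℕ) (τ : ℝ) :
    Integrable fun r => r ^ n * exp (τ * r - V r) :=
  (integrable_gibbsBase_iff hV (fun r => r ^ n) τ).1
    (integrable_pow_mul_exp_of_mem_interior_integrableExpSet
      (mem_interior_integrableExpSet_gibbsBase hV hexp τ) n)

lemma hasDerivAt_gibbsMoment (hV : Continuous V)
    (hexp : ∀ τ, Integrable fun r => exp (τ * r - V r)) (n : ℕ) (τ : ℝ) :
    HasDerivAt (gibbsMoment V n) (gibbsMoment V (n + 1) τ) τ := by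
  have h := hasDerivAt_integral_pow_mul_exp_real
    (mem_interior_integrableExpSet_gibbsBase hV hexp τ) n
  simp only [id] at h
  rw [integral_gibbsBase hV (fun r => r ^ (n + 1))] at h
  simp only [integral_gibbsBase hV (fun r => r ^ n)] at h
  exact h

lemma gibbsMoment_zero_pos (hexp : ∀ τ, Integrable fun r => exp (τ * r - V r)) (τ : ℝ) :
    0 < gibbsMoment V 0 τ := by
  simpa [gibbsMoment] using integral_exp_pos (hexp τ)

lemma gibbsG_eq_log_gibbsMoment : gibbsG V = fun τ => log (gibbsMoment V 0 τ) := by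
  ext τ
  simp [gibbsG, gibbsMoment]

lemma gibbsDensity_eq (hexp : ∀ τ, Integrable fun r => exp (τ * r - V r)) (τ r : ℝ) :
    exp (τ * r - V r - gibbsG V τ) = exp (τ * r - V r) / gibbsMoment V 0 τ := by
  rw [exp_sub, gibbsG_eq_log_gibbsMoment, exp_log (gibbsMoment_zero_pos hexp τ)]

lemma integral_gibbsMeasure (hV : Continuous V)
    (hexp : ∀ τ, Integrable fun r => exp (τ * r - V r)) (g : ℝ → ℝ) (τ : ℝ) :
    ∫ r, g r ∂(gibbsMeasure V τ)
      = (∫ r, g r * exp (τ * r - V r)) / gibbsMoment V 0 τ := by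
  rw [gibbsMeasure, integral_withDensity_eq_integral_toReal_smul (by fun_prop) (by simp),
    ← integral_div]
  refine integral_congr_ae (.of_forall fun r => ?_)
  simp only [ENNReal.toReal_ofReal (exp_pos _).le, smul_eq_mul]
  rw [gibbsDensity_eq hexp]
  ring

lemma integrable_pow_gibbsMeasure (hV : Continuous V)
    (hexp : ∀ τ, Integrable fun r => exp (τ * r - V r)) (n : ℕ) (τ : ℝ) :
    Integrable (fun r => r ^ n) (gibbsMeasure V τ) := by
  rw [gibbsMeasure, integrable_withDensity_iff (by fun_prop) (by simp)]
  refine ((integrable_pow_mul_exp_linear_sub_potential hV hexp n τ).div_const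
    (gibbsMoment V 0 τ)).congr (.of_forall fun r => ?_)
  simp only [ENNReal.toReal_ofReal (exp_pos _).le]
  rw [gibbsDensity_eq hexp]
  ring

lemma isProbabilityMeasure_gibbsMeasure
    (hexp : ∀ τ, Integrable fun r => exp (τ * r - V r)) (τ : ℝ) :
    IsProbabilityMeasure (gibbsMeasure V τ) := by
  constructor
  have hpos := gibbsMoment_zero_pos hexp τ
  rw [gibbsMeasure, withDensity_apply _ MeasurableSet.univ, Measure.restrict_univ]
  simp only [gibbsDensity_eq hexp]
  rw [← ofReal_integral_eq_lintegral_ofReal ((hexp τ).div_const _)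
    (.of_forall fun r => by positivity), integral_div]
  have : ∫ r, exp (τ * r - V r) = gibbsMoment V 0 τ := by simp [gibbsMoment]
  rw [this, div_self hpos.ne', ENNReal.ofReal_one]

lemma hasDerivAt_gibbsMeasure_moment (hV : Continuous V)
    (hexp : ∀ τ, Integrable fun r => exp (τ * r - V r)) (n : ℕ) (τ : ℝ) :
    HasDerivAt (fun t => ∫ r, r ^ n ∂(gibbsMeasure V t))
      (∫ r, r ^ (n + 1) ∂(gibbsMeasure V τ)
        - (∫ r, r ^ n ∂(gibbsMeasure V τ)) * ∫ r, r ^ 1 ∂(gibbsMeasure V τ)) τ := by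
  have hpos := (gibbsMoment_zero_pos hexp τ).ne'
  simp only [integral_gibbsMeasure hV hexp]
  refine ((hasDerivAt_gibbsMoment hV hexp n τ).div
    (hasDerivAt_gibbsMoment hV hexp 0 τ) hpos).congr_deriv ?_
  change _ = gibbsMoment V (n + 1) τ / gibbsMoment V 0 τ
    - gibbsMoment V n τ / gibbsMoment V 0 τ * (gibbsMoment V 1 τ / gibbsMoment V 0 τ)
  field_simp

lemma deriv_gibbsG (hV : Continuous V)
    (hexp : ∀ τ, Integrable fun r => exp (τ * r - V r)) :
    deriv (gibbsG V) = fun τ => ∫ r, r ^ 1 ∂(gibbsMeasure V τ) := by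
  ext τ
  have h := (hasDerivAt_gibbsMoment hV hexp 0 τ).log (gibbsMoment_zero_pos hexp τ).ne'
  rw [gibbsG_eq_log_gibbsMoment, h.deriv, integral_gibbsMeasure hV hexp]
  rfl

lemma iteratedDeriv_two_gibbsG (hV : Continuous V)
    (hexp : ∀ τ, Integrable fun r => exp (τ * r - V r)) :
    iteratedDeriv 2 (gibbsG V) = fun τ =>
      ∫ r, r ^ 2 ∂(gibbsMeasure V τ) - (∫ r, r ^ 1 ∂(gibbsMeasure V τ)) ^ 2 := by
  ext τ
  rw [iteratedDeriv_succ, iteratedDeriv_one, deriv_gibbsG hV hexp,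
    (hasDerivAt_gibbsMeasure_moment hV hexp 1 τ).deriv]
  ring

lemma iteratedDeriv_three_gibbsG (hV : Continuous V)
    (hexp : ∀ τ, Integrable fun r => exp (τ * r - V r)) :
    iteratedDeriv 3 (gibbsG V) = fun τ =>
      ∫ r, r ^ 3 ∂(gibbsMeasure V τ)
        - 3 * (∫ r, r ^ 1 ∂(gibbsMeasure V τ)) * ∫ r, r ^ 2 ∂(gibbsMeasure V τ)
        + 2 * (∫ r, r ^ 1 ∂(gibbsMeasure V τ)) ^ 3 := by
  ext τ
  have h := hasDerivAt_gibbsMeasure_moment hV hexp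
  rw [iteratedDeriv_succ, iteratedDeriv_two_gibbsG hV hexp,
    ((h 2 τ).fun_sub ((h 1 τ).fun_pow 2)).deriv]
  push_cast
  ring

lemma iteratedDeriv_four_gibbsG (hV : Continuous V)
    (hexp : ∀ τ, Integrable fun r => exp (τ * r - V r)) (τ : ℝ) :
    iteratedDeriv 4 (gibbsG V) τ =
      ∫ r, r ^ 4 ∂(gibbsMeasure V τ)
        - 4 * (∫ r, r ^ 1 ∂(gibbsMeasure V τ)) * ∫ r, r ^ 3 ∂(gibbsMeasure V τ)
        - 3 * (∫ r, r ^ 2 ∂(gibbsMeasure V τ)) ^ 2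
        + 12 * (∫ r, r ^ 1 ∂(gibbsMeasure V τ)) ^ 2 * ∫ r, r ^ 2 ∂(gibbsMeasure V τ)
        - 6 * (∫ r, r ^ 1 ∂(gibbsMeasure V τ)) ^ 4 := by
  have h := hasDerivAt_gibbsMeasure_moment hV hexp
  rw [iteratedDeriv_succ, iteratedDeriv_three_gibbsG hV hexp,
    (((h 3 τ).fun_sub (((h 1 τ).const_mul 3).fun_mul (h 2 τ))).fun_add
      (((h 1 τ).fun_pow 3).const_mul 2)).deriv]
  push_cast
  ring

end GibbsMoments


/-- `G` is four times differentiable with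
`G'''(τ) = ∫ (r - G'(τ))³ dλ_τ(r)` and
`G''''(τ) = ∫ (r - G'(τ))⁴ dλ_τ(r) - 3 G''(τ)²`, and both `G'''` and `G''''`
are bounded functions on `ℝ`. -/
theorem gibbsG_third_fourth_deriv_formula_and_bounded
    (V : ℝ → ℝ) (c₁ c₂ : ℝ) (hc₁ : 0 < c₁)
    (hV : ContDiff ℝ 2 V)
    (hlow : ∀ r : ℝ, c₁ ≤ deriv (deriv V) r)
    (hhigh : ∀ r : ℝ, deriv (deriv V) r ≤ c₂) :
    ContDiff ℝ 4 (gibbsG V) ∧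
    (∀ τ : ℝ,
      iteratedDeriv 3 (gibbsG V) τ
        = (∫ r : ℝ, (r - deriv (gibbsG V) τ) ^ 3 ∂(gibbsMeasure V τ)) ∧
      iteratedDeriv 4 (gibbsG V) τ
        = (∫ r : ℝ, (r - deriv (gibbsG V) τ) ^ 4 ∂(gibbsMeasure V τ))
          - 3 * (iteratedDeriv 2 (gibbsG V) τ) ^ 2) ∧
    (∃ C : ℝ, ∀ τ : ℝ,
      |iteratedDeriv 3 (gibbsG V) τ| ≤ C ∧ |iteratedDeriv 4 (gibbsG V) τ| ≤ C) := by
  have hcont := hV.continuous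
  have hexp := integrable_exp_linear_sub_potential hc₁ hV hlow
  have hpow := integrable_pow_gibbsMeasure hcont hexp
  have hprob := isProbabilityMeasure_gibbsMeasure hexp
  have h1 := deriv_gibbsG hcont hexp
  have h2 : ∀ τ, iteratedDeriv 2 (gibbsG V) τ
      = ∫ r, (r - deriv (gibbsG V) τ) ^ 2 ∂(gibbsMeasure V τ) := fun τ => by
    rw [iteratedDeriv_two_gibbsG hcont hexp, h1, integral_sub_pow_two (hpow · τ)]
    ring
  have h3 : ∀ τ, iteratedDeriv 3 (gibbsG V) τ
      = ∫ r, (r - deriv (gibbsG V) τ) ^ 3 ∂(gibbsMeasure V τ) := fun τ => by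
    rw [iteratedDeriv_three_gibbsG hcont hexp, h1, integral_sub_pow_three (hpow · τ)]
    ring
  have h4 : ∀ τ, iteratedDeriv 4 (gibbsG V) τ
      = (∫ r, (r - deriv (gibbsG V) τ) ^ 4 ∂(gibbsMeasure V τ))
        - 3 * (iteratedDeriv 2 (gibbsG V) τ) ^ 2 := fun τ => by
    rw [iteratedDeriv_four_gibbsG hcont hexp, iteratedDeriv_two_gibbsG hcont hexp, h1,
      integral_sub_pow_four (hpow · τ)]
    ring
  refine ⟨contDiff_gibbsG hcont hexp, fun τ => ⟨h3 τ, h4 τ⟩, ?_⟩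
  obtain ⟨K, hK₀, hK⟩ := exists_integral_sub_pow_four_mul_exp_le hc₁ hV hlow hhigh
  set L := 8 * (K + (1 + K) ^ 4)
  have hL₀ : 0 ≤ L := by positivity
  have hL : ∀ τ, ∫ r, (r - deriv (gibbsG V) τ) ^ 4 ∂(gibbsMeasure V τ) ≤ L := fun τ => by
    obtain ⟨a, ha⟩ := hK τ
    rw [h1]
    refine integral_sub_mean_pow_four_le (hpow · τ) (a := a) ?_
    rw [integral_gibbsMeasure hcont hexp, div_le_iff₀ (gibbsMoment_zero_pos hexp τ)]
    simpa [gibbsMoment] using ha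
  refine ⟨L + 3 * (1 + L) ^ 2 + 1, fun τ => ⟨?_, ?_⟩⟩
  · have := abs_integral_sub_pow_le_one_add (hpow · τ) (deriv (gibbsG V) τ) (k := 3)
      (by norm_num)
    rw [h3]
    nlinarith [hL τ]
  · have habs := abs_integral_sub_pow_le_one_add (hpow · τ) (deriv (gibbsG V) τ) (k := 2)
      (by norm_num)
    rw [← h2] at habs
    have hsq : (iteratedDeriv 2 (gibbsG V) τ) ^ 2 ≤ (1 + L) ^ 2 :=
      sq_le_sq.2 (by rw [abs_of_nonneg (by positivity : 0 ≤ 1 + L)]; linarith [hL τ])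
    have hnn : 0 ≤ ∫ r, (r - deriv (gibbsG V) τ) ^ 4 ∂(gibbsMeasure V τ) :=
      integral_nonneg fun r => by positivity
    rw [h4, abs_le]
    constructor <;> nlinarith [hL τ, sq_nonneg (iteratedDeriv 2 (gibbsG V) τ)]
end

section
/- There exist constants C > 0 and α̃ > 0 such that for all sufficiently large τ > 0: |G''(τ) − 1/V''₊| ≤ C e^{−α̃ τ}, |G'''(τ)| ≤ C e^{−α̃ τ}, and |G''''(τ)| ≤ C e^{−α̃ τ}; in particular G''(τ) → 1/V''₊, G'''(τ) → 0 and G''''(τ) → 0 as τ → +∞. -/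
open MeasureTheory Real Filter

/-- A function whose derivative decays exponentially converges exponentially fast. -/
lemma exists_abs_sub_le_exp_of_abs_deriv_le {f : ℝ → ℝ} (hf : Differentiable ℝ f)
    {C α R : ℝ} (hα : 0 < α) (h : ∀ r, R < r → |deriv f r| ≤ C * exp (-α * r)) :
    ∃ ℓ, ∀ r, R < r → |f r - ℓ| ≤ C / α * exp (-α * r) := by
  have hE : ∀ r, HasDerivAt (fun r => C / α * exp (-α * r)) (-(C * exp (-α * r))) r := by
    intro r
    convert! (((hasDerivAt_id r).const_mul (-α)).exp.const_mul (C / α)) using 1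
    field_simp
    simp
  have hC : ∀ r, R < r → 0 ≤ C / α * exp (-α * r) := fun r hr => by
    have := (abs_nonneg _).trans (h r hr)
    have hC : 0 ≤ C := nonneg_of_mul_nonneg_left this (exp_pos _)
    positivity
  have hd1 : ∀ r, HasDerivAt (fun r => f r - C / α * exp (-α * r))
      (deriv f r + C * exp (-α * r)) r := fun r => by
    convert! (hf r).hasDerivAt.sub (hE r) using 1
    ring
  have hd2 : ∀ r, HasDerivAt (fun r => f r + C / α * exp (-α * r))
      (deriv f r - C * exp (-α * r)) r := fun r => by
    convert! (hf r).hasDerivAt.add (hE r) using 1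
  have hmono : MonotoneOn (fun r => f r - C / α * exp (-α * r)) (Set.Ioi R) := by
    refine monotoneOn_of_deriv_nonneg (convex_Ioi R)
      (fun r _ => (hd1 r).continuousAt.continuousWithinAt)
      (fun r _ => (hd1 r).differentiableAt.differentiableWithinAt) fun r hr => ?_
    rw [interior_Ioi] at hr
    rw [(hd1 r).deriv]
    linarith [(abs_le.1 (h r hr)).1]
  have hanti : AntitoneOn (fun r => f r + C / α * exp (-α * r)) (Set.Ioi R) := by
    refine antitoneOn_of_deriv_nonpos (convex_Ioi R)
      (fun r _ => (hd2 r).continuousAt.continuousWithinAt)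
      (fun r _ => (hd2 r).differentiableAt.differentiableWithinAt) fun r hr => ?_
    rw [interior_Ioi] at hr
    rw [(hd2 r).deriv]
    linarith [(abs_le.1 (h r hr)).2]
  obtain ⟨ℓ, hl, hu⟩ := exists_between_of_forall_le
    (s := (fun r => f r - C / α * exp (-α * r)) '' Set.Ioi R)
    (t := (fun r => f r + C / α * exp (-α * r)) '' Set.Ioi R)
    (Set.nonempty_Ioi.image _) (Set.nonempty_Ioi.image _) (by
      rintro _ ⟨s, hs, rfl⟩ _ ⟨t, ht, rfl⟩
      have hm : R < max s t := lt_max_of_lt_left hs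
      have h1 := hmono hs hm (le_max_left s t)
      have h2 := hanti ht hm (le_max_right s t)
      have h3 := hC _ hm
      simp only at h1 h2 ⊢
      linarith)
  refine ⟨ℓ, fun r hr => abs_le.2 ⟨?_, ?_⟩⟩
  · have := hu ⟨r, hr, rfl⟩
    simp only at this
    linarith
  · have := hl ⟨r, hr, rfl⟩
    simp only at this
    linarith

/-- If `V''` converges exponentially fast at `+∞`, then `V` is exponentially close to a quadratic
polynomial there. -/
lemma exists_abs_sub_quadratic_le_exp {V : ℝ → ℝ} (hV : ContDiff ℝ 2 V) {a α R : ℝ} (hα : 0 < α)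
    (h : ∀ r, R < r → |deriv (deriv V) r - a| ≤ exp (-α * r)) :
    ∃ b c, ∀ r, R < r → |V r - (a / 2 * r ^ 2 + b * r + c)| ≤ (1 / α / α) * exp (-α * r) := by
  have hV1 : Differentiable ℝ V := hV.differentiable (by norm_num)
  have hV2 : Differentiable ℝ (deriv V) :=
    (hV.differentiable_deriv_two)
  have e1 : ∀ r, HasDerivAt (fun r => deriv V r - a * r) (deriv (deriv V) r - a) r := fun r => by
    simpa using! (hV2 r).hasDerivAt.sub ((hasDerivAt_id r).const_mul a)
  obtain ⟨b, hb⟩ := exists_abs_sub_le_exp_of_abs_deriv_le (C := 1)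
    (fun r => (e1 r).differentiableAt) hα
    (fun r hr => by rw [(e1 r).deriv, one_mul]; exact h r hr)
  have e2 : ∀ r, HasDerivAt (fun r => V r - (a / 2 * r ^ 2 + b * r))
      (deriv V r - a * r - b) r := fun r => by
    convert! (hV1 r).hasDerivAt.sub (((hasDerivAt_pow 2 r).const_mul (a / 2)).add
      ((hasDerivAt_id r).const_mul b)) using 1
    push_cast
    ring
  obtain ⟨c, hc⟩ := exists_abs_sub_le_exp_of_abs_deriv_le
    (fun r => (e2 r).differentiableAt) hα
    (fun r hr => by rw [(e2 r).deriv]; exact hb r hr)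
  refine ⟨b, c, fun r hr => ?_⟩
  convert hc r hr using 2
  ring

/-- A uniformly convex function dominates a quadratic polynomial. -/
lemma quadratic_le_of_le_deriv_deriv {V : ℝ → ℝ} (hV : ContDiff ℝ 2 V) {m : ℝ}
    (h : ∀ r, m ≤ deriv (deriv V) r) (r : ℝ) :
    m / 2 * r ^ 2 + deriv V 0 * r + V 0 ≤ V r := by
  have hV1 : Differentiable ℝ V := hV.differentiable (by norm_num)
  have hV2 : Differentiable ℝ (deriv V) := hV.differentiable_deriv_two
  have e2 : ∀ r, HasDerivAt (fun r => V r - (m / 2 * r ^ 2 + deriv V 0 * r))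
      (deriv V r - m * r - deriv V 0) r := fun r => by
    convert! (hV1 r).hasDerivAt.sub (((hasDerivAt_pow 2 r).const_mul (m / 2)).add
      ((hasDerivAt_id r).const_mul (deriv V 0))) using 1
    push_cast
    ring
  have e3 : ∀ r, HasDerivAt (fun r => deriv V r - m * r - deriv V 0)
      (deriv (deriv V) r - m) r := fun r => by
    simpa using! ((hV2 r).hasDerivAt.sub ((hasDerivAt_id r).const_mul m)).sub_const (deriv V 0)
  have hconv : ConvexOn ℝ Set.univ (fun r => V r - (m / 2 * r ^ 2 + deriv V 0 * r)) := by
    refine MonotoneOn.convexOn_of_deriv convex_univ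
      (fun r _ => (e2 r).continuousAt.continuousWithinAt)
      (fun r _ => (e2 r).differentiableAt.differentiableWithinAt) ?_
    rw [funext fun r => (e2 r).deriv]
    refine Monotone.monotoneOn (monotone_of_deriv_nonneg
      (fun r => (e3 r).differentiableAt) fun r => ?_) _
    rw [(e3 r).deriv]
    linarith [h r]
  have hmin := hconv.isMinOn_of_rightDeriv_eq_zero (x := 0) (by simp) (by
    rw [(e2 0).hasDerivWithinAt.derivWithin (uniqueDiffWithinAt_Ioi 0)]
    simp) (Set.mem_univ r)
  simp only [Set.mem_ofPred_eq] at hmin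
  linarith

/-- The two-sided Laplace transform of a quadratic exponential. -/
lemma exists_integral_cexp_mul_sub_quadratic {a : ℝ} (ha : 0 < a) (b c : ℝ) :
    ∃ K : ℝ, 0 < K ∧ ∀ z : ℂ,
      ∫ r : ℝ, Complex.exp (z * r - (a / 2 * r ^ 2 + b * r + c : ℝ)) =
        K * Complex.exp ((z - b) ^ 2 / (2 * a)) := by
  refine ⟨(π / (a / 2)) ^ (1 / 2 : ℝ) * exp (-c), by positivity, fun z => ?_⟩
  have h := integral_cexp_quadratic (b := ((-(a / 2) : ℝ) : ℂ))
    (by rw [Complex.ofReal_re]; linarith) (z - b) (-c)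
  have ha' : (a : ℂ) ≠ 0 := by exact_mod_cast ha.ne'
  have e : ∀ r : ℝ, z * r - ((a / 2 * r ^ 2 + b * r + c : ℝ) : ℂ) =
      ((-(a / 2) : ℝ) : ℂ) * r ^ 2 + (z - b) * r + -c := fun r => by push_cast; ring
  simp_rw [e]
  rw [h, Complex.ofReal_mul, Complex.ofReal_cpow (by positivity), Complex.ofReal_exp, mul_assoc,
    ← Complex.exp_add]
  congr 2
  · push_cast; ring
  · push_cast; ring
  · push_cast; field_simp; ring

lemma integrable_exp_mul_sub_quadratic {a : ℝ} (ha : 0 < a) (b c x : ℝ) :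
    Integrable fun r : ℝ => exp (x * r - (a / 2 * r ^ 2 + b * r + c)) := by
  have h := (integrable_cexp_quadratic' (b := ((-(a / 2) : ℝ) : ℂ))
    (by rw [Complex.ofReal_re]; linarith) (x - b) (-c)).norm
  refine h.congr (ae_of_all _ fun r => ?_)
  simp only [Complex.norm_exp]
  congr 1
  simp [← Complex.ofReal_pow]
  ring

lemma integrable_exp_mul_sub {V : ℝ → ℝ} (hV : ContDiff ℝ 2 V) {m : ℝ} (hm : 0 < m)
    (h : ∀ r, m ≤ deriv (deriv V) r) (x : ℝ) : Integrable fun r : ℝ => exp (x * r - V r) := by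
  have hc := hV.continuous
  refine (integrable_exp_mul_sub_quadratic hm (deriv V 0) (V 0) x).mono'
    (by fun_prop) (ae_of_all _ fun r => ?_)
  rw [norm_of_nonneg (exp_pos _).le]
  gcongr
  exact quadratic_le_of_le_deriv_deriv hV h r

/-- The Laplace transform of `exp (-V)` is entire when it converges on the whole real line. -/
lemma differentiable_integral_cexp_mul_sub {V : ℝ → ℝ} (hV : Continuous V)
    (h : ∀ x : ℝ, Integrable fun r : ℝ => exp (x * r - V r)) :
    Differentiable ℂ fun z : ℂ => ∫ r : ℝ, Complex.exp (z * r - V r) := by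
  set μ : Measure ℝ := volume.withDensity fun r => ENNReal.ofReal (exp (-V r)) with hμ
  have hmeas : Measurable fun r => ENNReal.ofReal (exp (-V r)) := by fun_prop
  have htop : ∀ᵐ r ∂(volume : Measure ℝ), ENNReal.ofReal (exp (-V r)) < ⊤ :=
    ae_of_all _ fun r => ENNReal.ofReal_lt_top
  have hset : ProbabilityTheory.integrableExpSet id μ = Set.univ := by
    refine Set.eq_univ_of_forall fun x => ?_
    change Integrable (fun r => exp (x * id r)) μ
    rw [hμ, integrable_withDensity_iff hmeas htop]
    refine (h x).congr (ae_of_all _ fun r => ?_)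
    simp only [id]
    rw [ENNReal.toReal_ofReal (exp_pos _).le, ← exp_add, sub_eq_add_neg]
  have heq : (fun z : ℂ => ∫ r : ℝ, Complex.exp (z * r - V r)) =
      ProbabilityTheory.complexMGF id μ := by
    funext z
    rw [ProbabilityTheory.complexMGF, hμ, integral_withDensity_eq_integral_toReal_smul hmeas htop]
    refine integral_congr_ae (ae_of_all _ fun r => ?_)
    simp only [id]
    rw [ENNReal.toReal_ofReal (exp_pos _).le, Complex.real_smul, Complex.ofReal_exp,
      ← Complex.exp_add]
    congr 1
    push_cast
    ring
  rw [heq]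
  intro z
  refine (ProbabilityTheory.hasDerivAt_complexMGF ?_).differentiableAt
  simp [hset]

/-- Taking real parts along the real axis commutes with iterated differentiation. -/
lemma iteratedDeriv_re_comp_ofReal {F : ℂ → ℂ} {U : Set ℂ} (hU : IsOpen U)
    (hF : DifferentiableOn ℂ F U) (n : ℕ) {t : ℝ} (ht : (t : ℂ) ∈ U) :
    iteratedDeriv n (fun t : ℝ => (F t).re) t = (iteratedDeriv n F t).re := by
  induction n generalizing t with
  | zero => simp
  | succ n ih =>
    have hev : iteratedDeriv n (fun t : ℝ => (F t).re) =ᶠ[nhds t]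
        fun t : ℝ => (iteratedDeriv n F t).re := by
      filter_upwards [Complex.continuous_ofReal.continuousAt.preimage_mem_nhds
        (hU.mem_nhds ht)] with s hs using ih hs
    have hd : DifferentiableAt ℂ (iteratedDeriv n F) t := by
      rw [iteratedDeriv_eq_iterate]
      exact ((hF.analyticAt (hU.mem_nhds ht)).iterated_deriv n).differentiableAt
    rw [iteratedDeriv_succ, hev.deriv_eq, iteratedDeriv_succ]
    exact hd.hasDerivAt.real_of_complex.deriv

lemma abs_exp_sub_one_le_abs_mul_exp_abs (x : ℝ) : |exp x - 1| ≤ |x| * exp |x| := by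
  have h1 := add_one_le_exp x
  have h2 := add_one_le_exp (-x)
  have h3 : 1 ≤ exp |x| := one_le_exp (abs_nonneg x)
  have h4 : exp x ≤ exp |x| := exp_le_exp.2 (le_abs_self x)
  have h5 : exp x * exp (-x) = 1 := by rw [← exp_add]; simp
  have h6 : exp x - 1 ≤ x * exp x := by nlinarith [exp_pos x]
  have h7 : x * exp x ≤ |x| * exp |x| := by
    refine (mul_le_mul_of_nonneg_right (le_abs_self x) (exp_pos x).le).trans ?_
    gcongr
  have h8 : |x| ≤ |x| * exp |x| := le_mul_of_one_le_right (abs_nonneg x) h3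
  exact abs_le.2 ⟨by linarith [neg_abs_le x], by linarith⟩

/-- If `V` is exponentially close at `+∞` to the quadratic polynomial `a / 2 * r ^ 2 + b * r + c`,
then in a vertical strip the Laplace transform of `exp (-V)` is, up to a relative error which is
exponentially small in `z.re`, a Gaussian. -/
lemma exists_norm_integral_cexp_mul_gaussian_sub_one_le {V : ℝ → ℝ} (hVc : Continuous V)
    (hVi : ∀ x : ℝ, Integrable fun r : ℝ => exp (x * r - V r)) {a b c D α R : ℝ} (ha : 0 < a)
    (hα : 0 < α) (hD : 0 ≤ D) (hR : 0 ≤ R)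
    (h : ∀ r, R < r → |V r - (a / 2 * r ^ 2 + b * r + c)| ≤ D * exp (-α * r)) :
    ∃ k : ℝ, 0 < k ∧ ∃ C : ℝ, 0 < C ∧ ∀ z : ℂ, 0 ≤ z.re → |z.im| ≤ 1 →
      ‖(∫ r : ℝ, Complex.exp (z * r - V r)) * (k * Complex.exp (-((z - b) ^ 2 / (2 * a)))) - 1‖ ≤
        C * exp (-(α / a) * z.re) := by
  obtain ⟨K, hK, hg⟩ := exists_integral_cexp_mul_sub_quadratic ha b c
  set Q : ℝ → ℝ := fun r => a / 2 * r ^ 2 + b * r + c with hQ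
  have hQc : Continuous Q := by fun_prop
  have hQi : ∀ x : ℝ, Integrable fun r : ℝ => exp (x * r - Q r) :=
    integrable_exp_mul_sub_quadratic ha b c
  have hQint : ∀ x : ℝ, ∫ r : ℝ, exp (x * r - Q r) = K * exp ((x - b) ^ 2 / (2 * a)) := fun x => by
    rw [← Complex.ofReal_inj, ← integral_complex_ofReal]
    refine (integral_congr_ae (ae_of_all _ fun r => ?_)).trans ((hg x).trans ?_)
    · simp [hQ]
    · push_cast
      rfl
  set A : ℝ := ∫ r : ℝ, (exp (0 * r - V r) + exp (0 * r - Q r)) with hA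
  have hA0 : 0 ≤ A := integral_nonneg fun r => by positivity
  set B : ℝ := D * exp D with hB
  have hB0 : 0 ≤ B := by positivity
  -- pointwise estimate of the difference of the two integrands
  have hpt : ∀ x r : ℝ, 0 ≤ x → exp (x * r) * |exp (-V r) - exp (-Q r)| ≤
      exp (x * R) * (exp (0 * r - V r) + exp (0 * r - Q r)) + B * exp ((x - α) * r - Q r) := by
    intro x r hx
    rcases le_or_gt r R with hr | hr
    · have h1 : |exp (-V r) - exp (-Q r)| ≤ exp (0 * r - V r) + exp (0 * r - Q r) := by
        rw [zero_mul, zero_sub, zero_sub]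
        exact abs_le.2 ⟨by linarith [exp_pos (-V r)], by linarith [exp_pos (-Q r)]⟩
      have h2 : exp (x * r) ≤ exp (x * R) := by gcongr
      have h3 : 0 ≤ B * exp ((x - α) * r - Q r) := by positivity
      have h4 := mul_le_mul h2 h1 (abs_nonneg _) (exp_pos _).le
      linarith
    · have h1 := h r hr
      have h2 : D * exp (-α * r) ≤ D := by
        refine mul_le_of_le_one_right hD (exp_le_one_iff.2 ?_)
        nlinarith
      have h3 : exp (-V r) - exp (-Q r) = exp (-Q r) * (exp (-(V r - Q r)) - 1) := by
        rw [mul_sub, ← exp_add]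
        ring_nf
      have h4 : |exp (-(V r - Q r)) - 1| ≤ D * exp (-α * r) * exp D := by
        refine (abs_exp_sub_one_le_abs_mul_exp_abs _).trans ?_
        rw [abs_neg]
        gcongr
        exact h1.trans h2
      have h5 : exp (x * r) * |exp (-V r) - exp (-Q r)| ≤ B * exp ((x - α) * r - Q r) := by
        rw [h3, abs_mul, abs_of_pos (exp_pos _)]
        calc exp (x * r) * (exp (-Q r) * |exp (-(V r - Q r)) - 1|)
            ≤ exp (x * r) * (exp (-Q r) * (D * exp (-α * r) * exp D)) := by gcongr
          _ = B * (exp (x * r) * exp (-Q r) * exp (-α * r)) := by rw [hB]; ring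
          _ = B * exp ((x - α) * r - Q r) := by
            rw [← exp_add, ← exp_add]
            ring_nf
      have h6 : 0 ≤ exp (x * R) * (exp (0 * r - V r) + exp (0 * r - Q r)) := by positivity
      linarith
  have hcint : ∀ {W : ℝ → ℝ}, Continuous W → (∀ x : ℝ, Integrable fun r : ℝ => exp (x * r - W r)) →
      ∀ z : ℂ, Integrable fun r : ℝ => Complex.exp (z * r - W r) := by
    intro W hW hi z
    refine (hi z.re).mono' (by fun_prop) (ae_of_all _ fun r => ?_)
    simp [Complex.norm_exp]
  have hdiff : ∀ z : ℂ, 0 ≤ z.re →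
      ‖(∫ r : ℝ, Complex.exp (z * r - V r)) - ∫ r : ℝ, Complex.exp (z * r - Q r)‖ ≤
        exp (z.re * R) * A + B * (K * exp ((z.re - α - b) ^ 2 / (2 * a))) := by
    intro z hz
    have hi : Integrable fun r : ℝ =>
        exp (z.re * R) * (exp (0 * r - V r) + exp (0 * r - Q r)) :=
      ((hVi 0).add (hQi 0)).const_mul _
    rw [← integral_sub (hcint hVc hVi z) (hcint hQc hQi z), ← hQint, hA,
      ← integral_const_mul, ← integral_const_mul, ← integral_add hi ((hQi _).const_mul _)]
    refine norm_integral_le_of_norm_le (hi.add ((hQi _).const_mul _)) (ae_of_all _ fun r => ?_)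
    refine le_trans (le_of_eq ?_) (hpt z.re r hz)
    rw [sub_eq_add_neg (z * r : ℂ), sub_eq_add_neg (z * r : ℂ), Complex.exp_add, Complex.exp_add,
      ← mul_sub, norm_mul, Complex.norm_exp]
    congr 1
    · simp
    · rw [← Complex.ofReal_neg, ← Complex.ofReal_neg, ← Complex.ofReal_exp, ← Complex.ofReal_exp,
        ← Complex.ofReal_sub, Complex.norm_real, norm_eq_abs]
  refine ⟨K⁻¹, by positivity,
    exp (1 / (2 * a)) * (K⁻¹ * A * exp ((R + α / a) * b + a * (R + α / a) ^ 2 / 2) +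
      B * exp ((2 * α * b + α ^ 2) / (2 * a))) + 1, by positivity, fun z hz hz1 => ?_⟩
  have hKc : (K : ℂ) ≠ 0 := by exact_mod_cast hK.ne'
  have hE : Complex.exp ((z - b) ^ 2 / (2 * a)) * Complex.exp (-((z - b) ^ 2 / (2 * a))) = 1 := by
    rw [← Complex.exp_add, add_neg_cancel, Complex.exp_zero]
  have hfac : (∫ r : ℝ, Complex.exp (z * r - V r)) *
      (K⁻¹ * Complex.exp (-((z - b) ^ 2 / (2 * a)))) - 1 =
      ((∫ r : ℝ, Complex.exp (z * r - V r)) - ∫ r : ℝ, Complex.exp (z * r - Q r)) *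
        (K⁻¹ * Complex.exp (-((z - b) ^ 2 / (2 * a)))) := by
    rw [hg z, sub_mul]
    congr 1
    rw [mul_mul_mul_comm, hE, Complex.ofReal_inv, mul_inv_cancel₀ hKc, one_mul]
  have hnorm : ‖(K⁻¹ * Complex.exp (-((z - b) ^ 2 / (2 * a))) : ℂ)‖ ≤
      K⁻¹ * (exp (1 / (2 * a)) * exp (-((z.re - b) ^ 2 / (2 * a)))) := by
    rw [norm_mul, Complex.norm_real, norm_of_nonneg (inv_nonneg.2 hK.le), Complex.norm_exp, ← exp_add]
    gcongr
    have e : (z - b) ^ 2 / (2 * a) = (z - b) ^ 2 / ((2 * a : ℝ) : ℂ) := by push_cast; rfl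
    rw [e, Complex.neg_re, Complex.div_ofReal_re, ← sub_eq_add_neg, ← sub_div, ← neg_div]
    gcongr
    have : z.im ^ 2 ≤ 1 := (sq_le_one_iff_abs_le_one _).2 hz1
    simp only [sq, Complex.mul_re, Complex.sub_re, Complex.sub_im, Complex.ofReal_re,
      Complex.ofReal_im, sub_zero]
    nlinarith
  have hkey1 : exp (z.re * R) * exp (-((z.re - b) ^ 2 / (2 * a))) ≤
      exp ((R + α / a) * b + a * (R + α / a) ^ 2 / 2) * exp (-(α / a) * z.re) := by
    rw [← exp_add, ← exp_add, exp_le_exp]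
    have : (R + α / a) * b + a * (R + α / a) ^ 2 / 2 + -(α / a) * z.re -
        (z.re * R + -((z.re - b) ^ 2 / (2 * a))) = (z.re - b - a * (R + α / a)) ^ 2 / (2 * a) := by
      field_simp
      ring
    have h2 : 0 ≤ (z.re - b - a * (R + α / a)) ^ 2 / (2 * a) := by positivity
    linarith
  have hkey2 : exp ((z.re - α - b) ^ 2 / (2 * a)) * exp (-((z.re - b) ^ 2 / (2 * a))) =
      exp ((2 * α * b + α ^ 2) / (2 * a)) * exp (-(α / a) * z.re) := by
    rw [← exp_add, ← exp_add]
    congr 1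
    field_simp
    ring
  rw [hfac, norm_mul]
  calc _ ≤ (exp (z.re * R) * A + B * (K * exp ((z.re - α - b) ^ 2 / (2 * a)))) *
        (K⁻¹ * (exp (1 / (2 * a)) * exp (-((z.re - b) ^ 2 / (2 * a))))) :=
        mul_le_mul (hdiff z hz) hnorm (norm_nonneg _) (by positivity)
    _ = exp (1 / (2 * a)) * (K⁻¹ * A * (exp (z.re * R) * exp (-((z.re - b) ^ 2 / (2 * a)))) +
        B * (exp ((z.re - α - b) ^ 2 / (2 * a)) * exp (-((z.re - b) ^ 2 / (2 * a))))) := by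
        field_simp
    _ ≤ exp (1 / (2 * a)) * (K⁻¹ * A * (exp ((R + α / a) * b + a * (R + α / a) ^ 2 / 2) *
        exp (-(α / a) * z.re)) +
        B * (exp ((2 * α * b + α ^ 2) / (2 * a)) * exp (-(α / a) * z.re))) := by
        rw [hkey2]
        gcongr
    _ ≤ _ := by
        have := exp_pos (-(α / a) * z.re)
        linarith

/-- If `ψ` is exponentially close to `1` in a half-strip, then the derivatives of `log ψ` decay
exponentially along the real axis. -/
lemma exists_norm_iteratedDeriv_log_le {ψ : ℂ → ℂ} (hψ : Differentiable ℂ ψ) {C β : ℝ}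
    (hC : 0 < C) (hβ : 0 < β)
    (h : ∀ z : ℂ, 0 ≤ z.re → |z.im| ≤ 1 → ‖ψ z - 1‖ ≤ C * exp (-β * z.re)) :
    ∃ U : Set ℂ, IsOpen U ∧ DifferentiableOn ℂ (fun z => Complex.log (ψ z)) U ∧
      ∃ M : ℝ, 0 < M ∧ (∀ τ : ℝ, M ≤ τ → (τ : ℂ) ∈ U) ∧ ∃ C' : ℝ, 0 < C' ∧
        ∀ n : ℕ, ∀ τ : ℝ, M ≤ τ → ‖iteratedDeriv n (fun z => Complex.log (ψ z)) τ‖ ≤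
          n.factorial * 2 ^ n * C' * exp (-β * τ) := by
  obtain ⟨M, hM⟩ : ∃ M : ℝ, 0 ≤ M ∧ ∀ x, M ≤ x → C * exp (-β * x) ≤ 1 / 2 := by
    have ht : Tendsto (fun x : ℝ => C * exp (-β * x)) atTop (nhds 0) := by
      have := (tendsto_exp_atBot.comp
        (tendsto_id.const_mul_atTop_of_neg (neg_lt_zero.2 hβ))).const_mul C
      simpa using this
    obtain ⟨M, hM⟩ := eventually_atTop.1 (ht.eventually_le_const (by norm_num : (0 : ℝ) < 1 / 2))
    exact ⟨max M 0, le_max_right _ _, fun x hx => hM x ((le_max_left _ _).trans hx)⟩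
  obtain ⟨hM0, hM⟩ := hM
  set U : Set ℂ := {z | M < z.re} ∩ {z | |z.im| < 1} with hU
  have hUo : IsOpen U := (isOpen_lt continuous_const Complex.continuous_re).inter
    (isOpen_lt (continuous_abs.comp Complex.continuous_im) continuous_const)
  have hsmall : ∀ z ∈ U, ‖ψ z - 1‖ ≤ 1 / 2 := fun z hz =>
    (h z (hM0.trans hz.1.le) hz.2.le).trans (hM _ hz.1.le)
  have hd : DifferentiableOn ℂ (fun z => Complex.log (ψ z)) U := fun z hz => by
    refine ((hψ z).clog (Or.inl ?_)).differentiableWithinAt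
    have := (abs_le.1 ((Complex.abs_re_le_norm _).trans (hsmall z hz))).1
    simp only [Complex.sub_re, Complex.one_re] at this
    linarith
  have hball : ∀ τ : ℝ, M + 1 ≤ τ → Metric.closedBall (τ : ℂ) (1 / 2) ⊆ U := by
    intro τ hτ z hz
    rw [mem_closedBall_iff_norm] at hz
    have h1 := (abs_le.1 ((Complex.abs_re_le_norm _).trans hz)).1
    have h2 := (Complex.abs_im_le_norm _).trans hz
    simp only [Complex.sub_re, Complex.sub_im, Complex.ofReal_re, Complex.ofReal_im,
      sub_zero] at h1 h2
    exact ⟨show M < z.re by linarith, show |z.im| < 1 by linarith⟩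
  refine ⟨U, hUo, hd, M + 1, by linarith,
    fun τ hτ => hball τ hτ (Metric.mem_closedBall_self (by norm_num)),
    3 / 2 * C * exp (β / 2), by positivity, fun n τ hτ => ?_⟩
  have hcauchy := Complex.norm_iteratedDeriv_le_of_forall_mem_sphere_norm_le (c := (τ : ℂ))
    (R := 1 / 2) (C := 3 / 2 * C * exp (β / 2) * exp (-β * τ)) n (by norm_num)
    (f := fun z => Complex.log (ψ z))
    ((hd.mono (hball τ hτ)).diffContOnCl_ball subset_rfl) (fun z hz => by
      have hz' := Metric.sphere_subset_closedBall hz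
      have hzU := hball τ hτ hz'
      rw [mem_closedBall_iff_norm] at hz'
      have h1 := (abs_le.1 ((Complex.abs_re_le_norm _).trans hz')).1
      simp only [Complex.sub_re, Complex.ofReal_re] at h1
      have h2 := Complex.norm_log_one_add_half_le_self (hsmall z hzU)
      rw [add_sub_cancel] at h2
      calc ‖Complex.log (ψ z)‖ ≤ 3 / 2 * ‖ψ z - 1‖ := h2
        _ ≤ 3 / 2 * (C * exp (-β * z.re)) := by
          gcongr
          exact h z (hM0.trans hzU.1.le) hzU.2.le
        _ ≤ 3 / 2 * (C * (exp (β / 2) * exp (-β * τ))) := by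
          rw [← exp_add]
          gcongr
          nlinarith
        _ = _ := by ring)
  refine hcauchy.trans (le_of_eq ?_)
  rw [one_div, inv_pow, div_inv_eq_mul]
  ring

/-- The function `gibbsG V` is the sum of a quadratic polynomial and of the real part of a
holomorphic logarithm. -/
lemma gibbsG_eq_re_log_add {V : ℝ → ℝ} (hVi : ∀ x : ℝ, Integrable fun r : ℝ => exp (x * r - V r))
    {k : ℝ} (hk : 0 < k) (a b τ : ℝ) :
    gibbsG V τ = (Complex.log ((∫ r : ℝ, Complex.exp ((τ : ℂ) * r - V r)) *
      (k * Complex.exp (-(((τ : ℂ) - b) ^ 2 / (2 * a))))) +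
        (((τ : ℂ) - b) ^ 2 / (2 * a) - (Real.log k : ℂ))).re := by
  have hI : (∫ r : ℝ, Complex.exp ((τ : ℂ) * r - V r)) = (∫ r : ℝ, exp (τ * r - V r) : ℝ) := by
    rw [← integral_complex_ofReal]
    push_cast
    rfl
  have hpos : 0 < ∫ r : ℝ, exp (τ * r - V r) := integral_exp_pos (hVi τ)
  have e : (∫ r : ℝ, Complex.exp ((τ : ℂ) * r - V r)) *
      (k * Complex.exp (-(((τ : ℂ) - b) ^ 2 / (2 * a)))) =
      (((∫ r : ℝ, exp (τ * r - V r)) * (k * exp (-((τ - b) ^ 2 / (2 * a)))) : ℝ) : ℂ) := by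
    rw [hI]
    push_cast
    rfl
  have e2 : ((τ : ℂ) - b) ^ 2 / (2 * a) - (Real.log k : ℂ) =
      (((τ - b) ^ 2 / (2 * a) - Real.log k : ℝ) : ℂ) := by
    push_cast
    rfl
  rw [e, e2, ← Complex.ofReal_log (by positivity), ← Complex.ofReal_add, Complex.ofReal_re,
    Real.log_mul hpos.ne' (by positivity), Real.log_mul hk.ne' (exp_pos _).ne', Real.log_exp,
    gibbsG]
  ring

/-- there are `C > 0`, `α̃ > 0` such that for all sufficiently large `τ > 0`:
`|G''(τ) - 1/V''₊| ≤ C e^{-α̃ τ}`, `|G'''(τ)| ≤ C e^{-α̃ τ}`, `|G''''(τ)| ≤ C e^{-α̃ τ}`;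
in particular `G''(τ) → 1/V''₊`, `G'''(τ) → 0` and `G''''(τ) → 0` as `τ → +∞`. -/
theorem gibbsG_derivs_exp_convergence_at_top
    (V : ℝ → ℝ) (c₁ c₂ : ℝ) (hc₁ : 0 < c₁)
    (hV : ContDiff ℝ 2 V)
    (hlow : ∀ r : ℝ, c₁ ≤ deriv (deriv V) r)
    (hhigh : ∀ r : ℝ, deriv (deriv V) r ≤ c₂)
    (Vpp Vmm α R : ℝ) (hVpp : 0 < Vpp) (hVmm : 0 < Vmm) (hα : 0 < α) (hR : 0 < R)
    (hplus : ∀ r : ℝ, R < r → |deriv (deriv V) r - Vpp| ≤ Real.exp (-α * r))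
    (hminus : ∀ r : ℝ, r < -R → |deriv (deriv V) r - Vmm| ≤ Real.exp (α * r)) :
    (∃ C > (0:ℝ), ∃ α' > (0:ℝ), ∃ M : ℝ, 0 < M ∧ ∀ τ : ℝ, M ≤ τ →
      |iteratedDeriv 2 (gibbsG V) τ - 1 / Vpp| ≤ C * Real.exp (-α' * τ) ∧
      |iteratedDeriv 3 (gibbsG V) τ| ≤ C * Real.exp (-α' * τ) ∧
      |iteratedDeriv 4 (gibbsG V) τ| ≤ C * Real.exp (-α' * τ)) ∧
    Tendsto (iteratedDeriv 2 (gibbsG V)) atTop (nhds (1 / Vpp)) ∧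
    Tendsto (iteratedDeriv 3 (gibbsG V)) atTop (nhds 0) ∧
    Tendsto (iteratedDeriv 4 (gibbsG V)) atTop (nhds 0) := by
  have hVi := integrable_exp_mul_sub hV hc₁ hlow
  obtain ⟨b, c, hbc⟩ := exists_abs_sub_quadratic_le_exp hV hα hplus
  obtain ⟨k, hk, C, hC, hψ⟩ := exists_norm_integral_cexp_mul_gaussian_sub_one_le hV.continuous hVi
    hVpp hα (by positivity) hR.le hbc
  have hβ : 0 < α / Vpp := by positivity
  obtain ⟨U, hU, hd, M, hM, hMU, C', hC', hbd⟩ := exists_norm_iteratedDeriv_log_le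
    (ψ := fun z => (∫ r : ℝ, Complex.exp (z * r - V r)) *
      (k * Complex.exp (-((z - b) ^ 2 / (2 * Vpp)))))
    ((differentiable_integral_cexp_mul_sub hV.continuous hVi).mul (by fun_prop)) hC hβ hψ
  set L : ℂ → ℂ := fun z => Complex.log ((∫ r : ℝ, Complex.exp (z * r - V r)) *
      (k * Complex.exp (-((z - b) ^ 2 / (2 * Vpp))))) with hL
  set q : ℂ → ℂ := fun z => (z - b) ^ 2 / (2 * Vpp) - (Real.log k : ℂ) with hq
  have hVc : (Vpp : ℂ) ≠ 0 := by exact_mod_cast hVpp.ne'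
  have hqd : Differentiable ℂ q := by fun_prop
  have hG : gibbsG V = fun τ : ℝ => (L τ + q τ).re :=
    funext fun τ => gibbsG_eq_re_log_add hVi hk Vpp b τ
  have hder : ∀ n : ℕ, ∀ τ : ℝ, M ≤ τ →
      iteratedDeriv n (gibbsG V) τ = (iteratedDeriv n L τ).re + (iteratedDeriv n q τ).re := by
    intro n τ hτ
    rw [hG, iteratedDeriv_re_comp_ofReal (F := fun z => L z + q z) hU
      (hd.add hqd.differentiableOn) n (hMU τ hτ), iteratedDeriv_fun_add, Complex.add_re]
    · exact (hd.analyticAt (hU.mem_nhds (hMU τ hτ))).contDiffAt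
    · exact hqd.contDiff.contDiffAt
  have hq1 : deriv q = fun z : ℂ => (z - b) / Vpp := by
    funext z
    have : HasDerivAt q ((z - b) / Vpp) z := by
      convert! ((((hasDerivAt_id z).sub_const (b : ℂ)).pow 2).div_const (2 * (Vpp : ℂ))).sub_const
        (Real.log k : ℂ) using 1
      simp only [id]
      field_simp
      simp [mul_comm]
    exact this.deriv
  have hq2 : iteratedDeriv 2 q = fun _ => (1 / Vpp : ℂ) := by
    rw [iteratedDeriv_succ, iteratedDeriv_one, hq1]
    funext z
    simp
  have hq3 : iteratedDeriv 3 q = fun _ => 0 := by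
    rw [iteratedDeriv_succ, hq2]
    funext z
    simp
  have hq4 : iteratedDeriv 4 q = fun _ => 0 := by
    rw [iteratedDeriv_succ, hq3]
    funext z
    simp
  have hmain : ∀ n : ℕ, n ≤ 4 → ∀ τ : ℝ, M ≤ τ →
      |(iteratedDeriv n L τ).re| ≤ 384 * C' * exp (-(α / Vpp) * τ) := by
    intro n hn τ hτ
    refine ((Complex.abs_re_le_norm _).trans (hbd n τ hτ)).trans ?_
    gcongr
    have h1 : (n.factorial : ℝ) ≤ 24 := by exact_mod_cast Nat.factorial_le hn
    have h2 : (2 : ℝ) ^ n ≤ 2 ^ 4 := pow_le_pow_right₀ (by norm_num) hn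
    calc (n.factorial : ℝ) * 2 ^ n ≤ 24 * 2 ^ 4 := by gcongr
      _ = 384 := by norm_num
  have hbound : ∀ τ : ℝ, M ≤ τ →
      |iteratedDeriv 2 (gibbsG V) τ - 1 / Vpp| ≤ 384 * C' * exp (-(α / Vpp) * τ) ∧
      |iteratedDeriv 3 (gibbsG V) τ| ≤ 384 * C' * exp (-(α / Vpp) * τ) ∧
      |iteratedDeriv 4 (gibbsG V) τ| ≤ 384 * C' * exp (-(α / Vpp) * τ) := by
    intro τ hτ
    have h1 : (1 / (Vpp : ℂ)).re = 1 / Vpp := by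
      rw [← Complex.ofReal_one, ← Complex.ofReal_div, Complex.ofReal_re]
    rw [hder 2 τ hτ, hder 3 τ hτ, hder 4 τ hτ, hq2, hq3, hq4, h1, add_sub_cancel_right,
      Complex.zero_re, add_zero, add_zero]
    exact ⟨hmain 2 (by norm_num) τ hτ, hmain 3 (by norm_num) τ hτ, hmain 4 le_rfl τ hτ⟩
  have hlim : Tendsto (fun τ : ℝ => 384 * C' * exp (-(α / Vpp) * τ)) atTop (nhds 0) := by
    have := (tendsto_exp_atBot.comp
      (tendsto_id.const_mul_atTop_of_neg (neg_lt_zero.2 hβ))).const_mul (384 * C')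
    simpa using this
  refine ⟨⟨384 * C', by positivity, α / Vpp, hβ, M, hM, hbound⟩, ?_, ?_, ?_⟩
  · rw [tendsto_iff_norm_sub_tendsto_zero]
    exact squeeze_zero' (Eventually.of_forall fun _ => norm_nonneg _)
      ((eventually_ge_atTop M).mono fun τ hτ => (hbound τ hτ).1) hlim
  · exact squeeze_zero_norm' ((eventually_ge_atTop M).mono fun τ hτ => (hbound τ hτ).2.1) hlim
  · exact squeeze_zero_norm' ((eventually_ge_atTop M).mono fun τ hτ => (hbound τ hτ).2.2) hlim
end
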